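/- Marginal gain lower bound (monotonicity step of Theorem 2): Let λ > 0, θ ∈ ℝ^D, let S ⊂ ℝ^D be a finite set and a ∈ ℝ^D with a ∉ S. Define V(R) = λI + Σ_{v∈R} v vᵀ for finite R ⊂ ℝ^D and Ψ(R) = Σ_{v∈R} ⟨v, θ⟩ + Σ_{v∈R} sqrt( vᵀ V(R)^{-1} v ). Suppose sqrt(vᵀ V(S)^{-1} v) ≤ 1/|S| for every v ∈ S. Then Ψ(S ∪ {a}) − Ψ(S) ≥ ⟨a, θ⟩. -/

import Mathlib

open Matrix Finset

/-- The design matrix `V(R) = λI + Σ_{v∈R} v vᵀ`. -/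
noncomputable def designMat (D : ℕ) (lam : ℝ) (R : Finset (Fin D → ℝ)) :
    Matrix (Fin D) (Fin D) ℝ :=
  lam • (1 : Matrix (Fin D) (Fin D) ℝ) + ∑ v ∈ R, vecMulVec v v

/-- The objective `Ψ(R) = Σ_{v∈R} ⟨v,θ⟩ + Σ_{v∈R} ‖v‖_{V(R)⁻¹}`. -/
noncomputable def Psi (D : ℕ) (lam : ℝ) (θ : Fin D → ℝ)
    (R : Finset (Fin D → ℝ)) : ℝ :=
  ∑ v ∈ R, v ⬝ᵥ θ + ∑ v ∈ R, Real.sqrt (v ⬝ᵥ (designMat D lam R)⁻¹ *ᵥ v)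

theorem Matrix.PosSemidef.sq_dotProduct_mulVec_le {n : Type*} [Fintype n]
    {A : Matrix n n ℝ} (hA : A.PosSemidef) (x y : n → ℝ) :
    (x ⬝ᵥ A *ᵥ y) ^ 2 ≤ (x ⬝ᵥ A *ᵥ x) * (y ⬝ᵥ A *ᵥ y) := by
  have hsymm : y ⬝ᵥ A *ᵥ x = x ⬝ᵥ A *ᵥ y := by
    have hT : Aᵀ = A := by simpa [Matrix.IsHermitian] using hA.isHermitian
    rw [dotProduct_mulVec, ← mulVec_transpose, hT, dotProduct_comm]
  have hquad : ∀ t : ℝ,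
      0 ≤ (y ⬝ᵥ A *ᵥ y) * (t * t) + 2 * (x ⬝ᵥ A *ᵥ y) * t + x ⬝ᵥ A *ᵥ x := by
    intro t
    have h : 0 ≤ (x + t • y) ⬝ᵥ A *ᵥ (x + t • y) := by
      simpa using hA.dotProduct_mulVec_nonneg (x + t • y)
    simp only [mulVec_add, mulVec_smul, dotProduct_add, add_dotProduct, smul_dotProduct,
      dotProduct_smul, smul_eq_mul, hsymm] at h
    linarith
  have := discrim_le_zero hquad
  rw [discrim] at this
  linarith

/-- A rank-one update by `a` shrinks the quadratic form of the inverse by a factor of at most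
`1 + aᵀ V⁻¹ a`. -/
theorem Matrix.PosDef.dotProduct_inv_mulVec_le_add_vecMulVec {n : Type*} [Fintype n]
    [DecidableEq n] {V : Matrix n n ℝ} (hV : V.PosDef) (a v : n → ℝ) :
    v ⬝ᵥ V⁻¹ *ᵥ v ≤ (1 + a ⬝ᵥ V⁻¹ *ᵥ a) * (v ⬝ᵥ (V + vecMulVec a a)⁻¹ *ᵥ v) := by
  have hW : (V + vecMulVec a a).PosDef :=
    hV.add_posSemidef (by simpa using posSemidef_vecMulVec_self_star a)
  set W := V + vecMulVec a a with hWdef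
  set y := V⁻¹ *ᵥ v with hy
  have hVy : V *ᵥ y = v := by
    rw [hy, mulVec_mulVec, mul_nonsing_inv _ ((isUnit_iff_isUnit_det _).1 hV.isUnit), one_mulVec]
  have hWinv : W⁻¹ *ᵥ (W *ᵥ y) = y := by
    rw [mulVec_mulVec, nonsing_inv_mul _ ((isUnit_iff_isUnit_det _).1 hW.isUnit), one_mulVec]
  have hcs := hW.inv.posSemidef.sq_dotProduct_mulVec_le v (W *ᵥ y)
  have hcs' := hV.inv.posSemidef.sq_dotProduct_mulVec_le a v
  have hWy : (W *ᵥ y) ⬝ᵥ y = v ⬝ᵥ y + (a ⬝ᵥ y) ^ 2 := by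
    rw [hWdef, add_mulVec, add_dotProduct, hVy, vecMulVec_mulVec]
    simp [smul_dotProduct, sq]
  rw [hWinv, hWy] at hcs
  rw [← hy] at hcs'
  have hv0 : 0 ≤ v ⬝ᵥ W⁻¹ *ᵥ v := by
    simpa using hW.inv.posSemidef.dotProduct_mulVec_nonneg v
  have ha0 : 0 ≤ a ⬝ᵥ V⁻¹ *ᵥ a := by
    simpa using hV.inv.posSemidef.dotProduct_mulVec_nonneg a
  by_contra! hlt
  have hpos : 0 < v ⬝ᵥ y := lt_of_le_of_lt (by positivity) hlt
  nlinarith [mul_le_mul_of_nonneg_left hcs' hv0, mul_lt_mul_of_pos_right hlt hpos]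

theorem designMat_posDef (D : ℕ) {lam : ℝ} (hlam : 0 < lam) (R : Finset (Fin D → ℝ)) :
    (designMat D lam R).PosDef :=
  (PosDef.one.smul hlam).add_posSemidef
    (posSemidef_sum R fun v _ => by simpa using posSemidef_vecMulVec_self_star v)

theorem designMat_insert (D : ℕ) (lam : ℝ) {S : Finset (Fin D → ℝ)} {a : Fin D → ℝ}
    (ha : a ∉ S) : designMat D lam (insert a S) = designMat D lam S + vecMulVec a a := by
  rw [designMat, designMat, sum_insert ha]
  abel

/-- Marginal gain lower bound (monotonicity step of Theorem 2). -/
theorem marginal_gain_lower_bound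
    (D : ℕ) (lam : ℝ) (hlam : 0 < lam) (θ : Fin D → ℝ)
    (S : Finset (Fin D → ℝ)) (a : Fin D → ℝ) (ha : a ∉ S)
    (hsmall : ∀ v ∈ S,
      Real.sqrt (v ⬝ᵥ (designMat D lam S)⁻¹ *ᵥ v) ≤ 1 / (S.card : ℝ)) :
    a ⬝ᵥ θ ≤ Psi D lam θ (insert a S) - Psi D lam θ S := by
  set V := designMat D lam S
  have hV : V.PosDef := designMat_posDef D hlam S
  have hs0 : 0 ≤ a ⬝ᵥ V⁻¹ *ᵥ a := by
    simpa using hV.inv.posSemidef.dotProduct_mulVec_nonneg a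
  set W := designMat D lam (insert a S) with hW
  set s := √(a ⬝ᵥ V⁻¹ *ᵥ a) with hs
  set t := √(1 + a ⬝ᵥ V⁻¹ *ᵥ a) with ht
  have hnorm (v : Fin D → ℝ) : √(v ⬝ᵥ V⁻¹ *ᵥ v) ≤ t * √(v ⬝ᵥ W⁻¹ *ᵥ v) := by
    rw [ht, ← Real.sqrt_mul (by positivity), hW, designMat_insert D lam ha]
    exact Real.sqrt_le_sqrt (hV.dotProduct_inv_mulVec_le_add_vecMulVec a v)
  have hsum : ∑ v ∈ S, √(v ⬝ᵥ V⁻¹ *ᵥ v) ≤ t * ∑ v ∈ S, √(v ⬝ᵥ W⁻¹ *ᵥ v) := by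
    rw [mul_sum]
    exact sum_le_sum fun v _ => hnorm v
  have hsum_le_one : ∑ v ∈ S, √(v ⬝ᵥ V⁻¹ *ᵥ v) ≤ 1 := by
    refine (sum_le_card_nsmul S _ _ hsmall).trans ?_
    rw [nsmul_eq_mul, mul_one_div]
    exact div_self_le_one _
  have ht_one : 1 ≤ t := Real.one_le_sqrt.2 (by linarith)
  have ht_le : t ≤ 1 + s := by
    refine Real.sqrt_le_iff.2 ⟨by positivity, ?_⟩
    nlinarith [Real.sq_sqrt hs0, Real.sqrt_nonneg (a ⬝ᵥ V⁻¹ *ᵥ a)]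
  have hnorm_a : s ≤ t * √(a ⬝ᵥ W⁻¹ *ᵥ a) := hnorm a
  have hkey : ∑ v ∈ S, √(v ⬝ᵥ V⁻¹ *ᵥ v) ≤
      √(a ⬝ᵥ W⁻¹ *ᵥ a) + ∑ v ∈ S, √(v ⬝ᵥ W⁻¹ *ᵥ v) := by
    refine le_of_mul_le_mul_left ?_ (zero_lt_one.trans_le ht_one)
    nlinarith [mul_le_mul_of_nonneg_left hsum_le_one (sub_nonneg.2 ht_one)]
  rw [Psi, Psi, sum_insert ha, sum_insert ha]
  linarith
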